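/- Let λ* = λ*(q,p) be the bifurcation value of the family x' = −x² + q(t)x + p(t) + λ. For every λ > λ*, the globally defined bounded solutions a_λ and r_λ are uniformly separated (inf_{t∈ℝ}(a_λ(t) − r_λ(t)) > 0), a_λ is an attractive hyperbolic solution, r_λ is a repulsive hyperbolic solution, and the equation has no other hyperbolic solutions. Moreover, λ*(q, p + μ) = λ*(q, p) − μ for every μ ∈ ℝ. -/

import Mathlib

open Set Filter

/-- The right-hand side of the quadratic equation `x' = -x² + Q(t)x + P(t)`. -/
def quadF (Q P : ℝ → ℝ) : ℝ → ℝ → ℝ := fun t x => -x ^ 2 + Q t * x + P t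

/-- `b` is a globally defined bounded solution of `x' = -x² + Q(t)x + P(t)`. -/
def IsBddSol (Q P b : ℝ → ℝ) : Prop :=
  (∀ t, HasDerivAt b (quadF Q P t (b t)) t) ∧ ∃ C, ∀ t, |b t| ≤ C

/-- `(k, β)` is a dichotomy constant pair witnessing that the variational equation
`z' = (-2 b(t) + Q(t)) z` is Hurwitz at `+∞` (attractive case). -/
def AttrDich (Q b : ℝ → ℝ) (k β : ℝ) : Prop :=
  1 ≤ k ∧ 0 < β ∧ ∀ s t : ℝ, s ≤ t →
    Real.exp (∫ l in s..t, (-2 * b l + Q l)) ≤ k * Real.exp (-β * (t - s))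

/-- `(k, β)` is a dichotomy constant pair witnessing that the variational equation
`z' = (-2 b(t) + Q(t)) z` is Hurwitz at `−∞` (repulsive case). -/
def RepDich (Q b : ℝ → ℝ) (k β : ℝ) : Prop :=
  1 ≤ k ∧ 0 < β ∧ ∀ s t : ℝ, t ≤ s →
    Real.exp (∫ l in s..t, (-2 * b l + Q l)) ≤ k * Real.exp (β * (t - s))

/-- `b` is an attractive hyperbolic solution of `x' = -x² + Q(t)x + P(t)`. -/
def IsAttrHyp (Q P b : ℝ → ℝ) : Prop := IsBddSol Q P b ∧ ∃ k β : ℝ, AttrDich Q b k β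

/-- `b` is a repulsive hyperbolic solution of `x' = -x² + Q(t)x + P(t)`. -/
def IsRepHyp (Q P b : ℝ → ℝ) : Prop := IsBddSol Q P b ∧ ∃ k β : ℝ, RepDich Q b k β

/-- `b` is a hyperbolic solution of `x' = -x² + Q(t)x + P(t)`. -/
def IsHyp (Q P b : ℝ → ℝ) : Prop := IsAttrHyp Q P b ∨ IsRepHyp Q P b

/-- The supremum norm distance between `f` and `g` is `< δ`. -/
def SupLt (f g : ℝ → ℝ) (δ : ℝ) : Prop := ∃ d : ℝ, d < δ ∧ ∀ t, |f t - g t| ≤ d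

/-- The family of maximal solutions `t ↦ X t s x₀` of the scalar ODE `x' = h (t, x)`. -/
structure MaxSolFamily (h : ℝ → ℝ → ℝ) where
  X : ℝ → ℝ → ℝ → ℝ
  dom : ℝ → ℝ → Set ℝ
  dom_open : ∀ s x₀, IsOpen (dom s x₀)
  dom_ordConn : ∀ s x₀, (dom s x₀).OrdConnected
  mem_dom : ∀ s x₀, s ∈ dom s x₀
  init : ∀ s x₀, X s s x₀ = x₀
  sol : ∀ s x₀, ∀ t ∈ dom s x₀, HasDerivAt (fun τ => X τ s x₀) (h t (X t s x₀)) t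
  maximal : ∀ s x₀ (y : ℝ → ℝ) (I : Set ℝ), IsOpen I → I.OrdConnected → s ∈ I →
      y s = x₀ → (∀ t ∈ I, HasDerivAt y (h t (y t)) t) →
      I ⊆ dom s x₀ ∧ ∀ t ∈ I, y t = X t s x₀

/-- The solution `X · s x₀` is (defined and) bounded as `t → −∞`. -/
def BddAtBot {h : ℝ → ℝ → ℝ} (F : MaxSolFamily h) (s x₀ : ℝ) : Prop :=
  ∃ C : ℝ, ∀ᶠ t in atBot, t ∈ F.dom s x₀ ∧ |F.X t s x₀| ≤ C

/-- The solution `X · s x₀` is (defined and) bounded as `t → ∞`. -/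
def BddAtTop {h : ℝ → ℝ → ℝ} (F : MaxSolFamily h) (s x₀ : ℝ) : Prop :=
  ∃ C : ℝ, ∀ᶠ t in atTop, t ∈ F.dom s x₀ ∧ |F.X t s x₀| ≤ C

/-- `a` is the globally defined bounded solution characterized by:
`X · s x₀` is bounded as `t → −∞` iff `x₀ ≤ a s`. -/
def CharA {h : ℝ → ℝ → ℝ} (F : MaxSolFamily h) (a : ℝ → ℝ) : Prop :=
  (∀ t, HasDerivAt a (h t (a t)) t) ∧ (∃ C, ∀ t, |a t| ≤ C) ∧
  ∀ s x₀ : ℝ, BddAtBot F s x₀ ↔ x₀ ≤ a s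

/-- `r` is the globally defined bounded solution characterized by:
`X · s x₀` is bounded as `t → ∞` iff `x₀ ≥ r s`. -/
def CharR {h : ℝ → ℝ → ℝ} (F : MaxSolFamily h) (r : ℝ → ℝ) : Prop :=
  (∀ t, HasDerivAt r (h t (r t)) t) ∧ (∃ C, ∀ t, |r t| ≤ C) ∧
  ∀ s x₀ : ℝ, BddAtTop F s x₀ ↔ r s ≤ x₀

/-- Some positive solution `E` of the variational equation along `a` has an antiderivative `G`
that is unbounded below, that is, `E` is not integrable at `-∞`. For a bounded solution `a` this
makes `a` the top bounded solution: see `charA_of_hasTopWitness`. -/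
def HasTopWitness (Q a : ℝ → ℝ) : Prop :=
  ∃ E G : ℝ → ℝ, (∀ t, 0 < E t) ∧ (∀ t, HasDerivAt E ((Q t - 2 * a t) * E t) t) ∧
    (∀ t, HasDerivAt G (E t) t) ∧ ∀ y, ∃ t, G t < y

theorem exists_pos_linear_solution {c : ℝ → ℝ} (hc : Continuous c) :
    ∃ E : ℝ → ℝ, (∀ t, 0 < E t) ∧ ∀ t, HasDerivAt E (c t * E t) t := by
  refine ⟨fun t => Real.exp (∫ l in (0:ℝ)..t, c l), fun t => Real.exp_pos _, fun t => ?_⟩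
  have h := (hc.integral_hasStrictDerivAt 0 t).hasDerivAt.exp
  rwa [mul_comm] at h

theorem exists_antideriv {E : ℝ → ℝ} (hE : Continuous E) :
    ∃ G : ℝ → ℝ, ∀ t, HasDerivAt G (E t) t :=
  ⟨fun t => ∫ l in (0:ℝ)..t, E l, fun t => (hE.integral_hasStrictDerivAt 0 t).hasDerivAt⟩

theorem linear_solution_eq {g d : ℝ → ℝ} (hg : Continuous g)
    (hd : ∀ t, HasDerivAt d (g t * d t) t) (s t : ℝ) :
    d t = d s * Real.exp (∫ l in s..t, g l) := by
  have h : ∀ t, HasDerivAt (fun t => d t * Real.exp (-∫ l in s..t, g l)) 0 t := fun t => by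
    have := (hd t).mul (hg.integral_hasStrictDerivAt s t).hasDerivAt.neg.exp
    refine HasDerivAt.congr_deriv this ?_
    simp only [Pi.neg_apply]
    ring
  have h2 := is_const_of_deriv_eq_zero (fun t => (h t).differentiableAt) (fun t => (h t).deriv) t s
  simp only [intervalIntegral.integral_same, neg_zero, Real.exp_zero, mul_one] at h2
  rw [← h2, mul_assoc, ← Real.exp_add]
  simp

theorem strictMono_of_forall_hasDerivAt_pos {E G : ℝ → ℝ} (hE : ∀ t, 0 < E t)
    (hG : ∀ t, HasDerivAt G (E t) t) : StrictMono G :=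
  strictMono_of_deriv_pos fun t => by rw [(hG t).deriv]; exact hE t

theorem monotone_of_forall_hasDerivAt_nonneg {f f' : ℝ → ℝ} (hf : ∀ t, HasDerivAt f (f' t) t)
    (h0 : ∀ t, 0 ≤ f' t) : Monotone f :=
  monotone_of_deriv_nonneg (fun t => (hf t).differentiableAt) fun t => by
    rw [(hf t).deriv]; exact h0 t

theorem continuous_of_forall_hasDerivAt {f f' : ℝ → ℝ} (hf : ∀ t, HasDerivAt f (f' t) t) :
    Continuous f :=
  continuous_iff_continuousAt.2 fun t => (hf t).continuousAt

/-- Explicit solutions of the quadratic equation from a known one. -/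
theorem hasDerivAt_add_div {Q P b E D : ℝ → ℝ} {z t : ℝ}
    (hb : HasDerivAt b (quadF Q P t (b t)) t)
    (hE : HasDerivAt E ((Q t - 2 * b t) * E t) t)
    (hD : HasDerivAt D (z * E t) t) (h0 : D t ≠ 0) :
    HasDerivAt (fun t => b t + z * E t / D t) (quadF Q P t (b t + z * E t / D t)) t := by
  refine HasDerivAt.congr_deriv (hb.add ((hE.const_mul z).div hD h0)) ?_
  simp only [quadF]
  field_simp
  ring

theorem exists_hasTopWitness {Q P b : ℝ → ℝ} (hQ : Continuous Q) (hQb : ∃ C, ∀ t, |Q t| ≤ C)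
    (hb : IsBddSol Q P b) : ∃ a, IsBddSol Q P a ∧ HasTopWitness Q a := by
  have hbc := continuous_of_forall_hasDerivAt hb.1
  obtain ⟨E, hE, hE'⟩ := exists_pos_linear_solution (c := fun t => Q t - 2 * b t) (by fun_prop)
  obtain ⟨G, hG⟩ := exists_antideriv (continuous_of_forall_hasDerivAt hE')
  by_cases hun : ∀ y, ∃ t, G t < y
  · exact ⟨b, hb, E, G, hE, hE', hG, hun⟩
  push Not at hun
  have hGm := strictMono_of_forall_hasDerivAt_pos hE hG
  have hbdd : BddBelow (range G) := by
    obtain ⟨y, hy⟩ := hun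
    exact ⟨y, by rintro _ ⟨t, rfl⟩; exact hy t⟩
  set L := sInf (range G) with hL
  have hGL : ∀ t, 0 < G t - L := fun t => by
    have h1 : L ≤ G (t - 1) := csInf_le hbdd ⟨_, rfl⟩
    have h2 : G (t - 1) < G t := hGm (by linarith)
    linarith
  have hGlim : ∀ y, L < y → ∃ t, G t < y := fun y hy => by
    obtain ⟨_, ⟨t, rfl⟩, ht⟩ := exists_lt_of_csInf_lt (range_nonempty G) hy
    exact ⟨t, ht⟩
  have hD : ∀ t, HasDerivAt (fun t => G t - L) (1 * E t) t := fun t => by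
    simpa using (hG t).sub_const L
  obtain ⟨Cq, hCq⟩ := hQb
  obtain ⟨Cb, hCb⟩ := hb.2
  set M := Cq + 2 * Cb
  have hM : ∀ t, |Q t - 2 * b t| ≤ M := fun t => by
    have h1 := abs_le.1 (hCq t)
    have h2 := abs_le.1 (hCb t)
    exact abs_le.2 ⟨by linarith, by linarith⟩
  have hsmall : ∀ t, ∀ η > 0, ∃ τ ≤ t, E τ ≤ η := by
    intro t η hη
    by_contra! hcon
    obtain ⟨τ, hτ, hlt⟩ : ∃ τ ≤ t, G t - η * (t - τ) < L :=
      ⟨t - (G t - L + 1) / η, by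
        have := hGL t
        have : 0 < (G t - L + 1) / η := by positivity
        linarith, by
        field_simp
        linarith⟩
    have hmono : MonotoneOn (fun x => G x - η * x) (Iic t) := by
      refine monotoneOn_of_hasDerivWithinAt_nonneg (f' := fun x => E x - η) (convex_Iic t)
        (fun x _ => ((hG x).sub ((hasDerivAt_id x).const_mul η)).continuousAt.continuousWithinAt)
        (fun x _ => ?_) (fun x hx => ?_)
      · exact (((hG x).sub ((hasDerivAt_id x).const_mul η)).congr_deriv
          (by simp)).hasDerivWithinAt
      · rw [interior_Iic] at hx
        have := hcon x hx.le
        linarith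
    have := hmono (mem_Iic.2 hτ) (mem_Iic.2 le_rfl) hτ
    simp only at this
    have := hGL τ
    linarith
  have hEle : ∀ t, E t ≤ M * (G t - L) := by
    intro t
    refine le_of_forall_pos_le_add fun η hη => ?_
    obtain ⟨τ, hτ, hEτ⟩ := hsmall t η hη
    have hmono : Monotone (fun x => M * G x - E x) :=
      monotone_of_forall_hasDerivAt_nonneg (fun x => ((hG x).const_mul M).sub (hE' x)) fun x => by
        have := abs_le.1 (hM x)
        nlinarith [hE x]
    have h1 := hmono hτ
    simp only at h1
    have hM0 : 0 ≤ M := (abs_nonneg _).trans (hM t)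
    nlinarith [mul_nonneg hM0 (hGL τ).le]
  refine ⟨fun t => b t + 1 * E t / (G t - L), ⟨fun t => ?_, Cb + M, fun t => ?_⟩,
    fun t => E t / (G t - L) ^ 2, fun t => -(G t - L)⁻¹, fun t => ?_, fun t => ?_, fun t => ?_,
    fun y => ?_⟩
  · exact hasDerivAt_add_div (hb.1 t) (hE' t) (hD t) (hGL t).ne'
  · have h1 : 1 * E t / (G t - L) ≤ M := by
      rw [one_mul, div_le_iff₀ (hGL t)]; exact hEle t
    have h2 : 0 < 1 * E t / (G t - L) := by
      have := hE t
      have := hGL t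
      positivity
    have h3 := abs_le.1 (hCb t)
    exact abs_le.2 ⟨by linarith, by linarith⟩
  · exact div_pos (hE t) (pow_pos (hGL t) 2)
  · have h0 := (hGL t).ne'
    refine HasDerivAt.congr_deriv ((hE' t).div ((hD t).pow 2) (pow_ne_zero 2 h0)) ?_
    field_simp
    ring
  · have h0 := (hGL t).ne'
    refine HasDerivAt.congr_deriv (((hD t).inv h0).neg) ?_
    field_simp
  · obtain ⟨t, ht⟩ := hGlim (L + (1 + |y|)⁻¹) (by
      have : 0 < (1 + |y|)⁻¹ := by positivity
      linarith)
    refine ⟨t, ?_⟩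
    have h1 : (1 + |y|) < (G t - L)⁻¹ := by
      rw [lt_inv_comm₀ (by positivity) (hGL t)]
      linarith
    have := neg_abs_le y
    linarith

theorem charA_of_hasTopWitness {Q P a : ℝ → ℝ} (hQb : ∃ C, ∀ t, |Q t| ≤ C)
    (F : MaxSolFamily (quadF Q P)) (ha : IsBddSol Q P a) (hw : HasTopWitness Q a) :
    CharA F a := by
  obtain ⟨E, G, hE, hE', hG, hun⟩ := hw
  have hGm := strictMono_of_forall_hasDerivAt_pos hE hG
  have hEc := continuous_of_forall_hasDerivAt hE'
  have hac := continuous_of_forall_hasDerivAt ha.1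
  refine ⟨ha.1, ha.2, fun s x₀ => ?_⟩
  obtain ⟨z, rfl⟩ : ∃ z, x₀ = a s + z := ⟨x₀ - a s, by ring⟩
  set D : ℝ → ℝ := fun t => E s + z * (G t - G s)
  have hD : ∀ t, HasDerivAt D (z * E t) t := fun t =>
    (((hG t).sub_const (G s)).const_mul z).const_add (E s)
  have hDs : D s = E s := by simp [D]
  have hys : a s + z * E s / D s = a s + z := by
    rw [hDs, mul_div_assoc, div_self (hE s).ne', mul_one]
  have hDc := continuous_of_forall_hasDerivAt hD
  constructor
  · rintro ⟨C, hC⟩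
    by_contra! hz
    replace hz : 0 < z := by linarith
    obtain ⟨T, hTs, hT⟩ : ∃ T < s, D T = 0 := by
      obtain ⟨t, ht⟩ := hun (G s - E s / z)
      have hts : t < s := hGm.lt_iff_lt.1 (ht.trans (by
        have := div_pos (hE s) hz
        linarith))
      have hDt : D t < 0 := by
        have : z * (G t - G s) < z * (-(E s / z)) := mul_lt_mul_of_pos_left (by linarith) hz
        rw [mul_neg, mul_div_cancel₀ _ hz.ne'] at this
        simp only [D]
        linarith
      obtain ⟨T, hT, hT0⟩ := intermediate_value_Ioo hts.le hDc.continuousOn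
        (show (0:ℝ) ∈ Ioo (D t) (D s) from ⟨hDt, hDs ▸ hE s⟩)
      exact ⟨T, hT.2, hT0⟩
    have hDpos : ∀ t ∈ Ioi T, 0 < D t := fun t ht => by
      have := mul_lt_mul_of_pos_left (hGm ht) hz
      simp only [D] at hT ⊢
      linarith
    have hmax := F.maximal s (a s + z) (fun t => a t + z * E t / D t) (Ioi T) isOpen_Ioi
      ordConnected_Ioi hTs hys
      fun t ht => hasDerivAt_add_div (ha.1 t) (hE' t) (hD t) (hDpos t ht).ne'
    obtain ⟨t₁, ⟨ht₁, -⟩, ht₁T⟩ := (hC.and (eventually_le_atBot T)).exists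
    have hTdom : T ∈ F.dom s (a s + z) :=
      (F.dom_ordConn s (a s + z)).out ht₁ (F.mem_dom _ _) ⟨ht₁T, hTs.le⟩
    have hXc := (F.sol _ _ T hTdom).continuousAt
    have hlim₁ : Tendsto (fun t => (F.X t s (a s + z) - a t) * D t) (nhdsWithin T (Ioi T))
        (nhds ((F.X T s (a s + z) - a T) * D T)) :=
      ((hXc.sub hac.continuousAt).mul hDc.continuousAt).tendsto.mono_left nhdsWithin_le_nhds
    have hlim₂ : Tendsto (fun t => (F.X t s (a s + z) - a t) * D t) (nhdsWithin T (Ioi T))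
        (nhds (z * E T)) := by
      refine ((hEc.const_mul z).continuousAt.tendsto.mono_left nhdsWithin_le_nhds).congr' ?_
      filter_upwards [self_mem_nhdsWithin] with t ht
      rw [← hmax.2 t ht]
      have := (hDpos t ht).ne'
      field_simp
      ring
    have := tendsto_nhds_unique hlim₁ hlim₂
    rw [hT, mul_zero] at this
    exact (mul_pos hz (hE T)).ne this
  · intro hz
    replace hz : z ≤ 0 := by linarith
    have hDanti : Antitone D := fun t t' h => by
      have := mul_le_mul_of_nonpos_left (hGm.monotone h) hz
      simp only [D]
      linarith
    have hIord : ({t | 0 < D t} : Set ℝ).OrdConnected :=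
      ⟨fun t _ t' ht' u hu => lt_of_lt_of_le ht' (hDanti hu.2)⟩
    have hmax := F.maximal s (a s + z) (fun t => a t + z * E t / D t) {t | 0 < D t}
      (isOpen_lt continuous_const hDc) hIord (by simpa [hDs] using hE s) hys
      fun t ht => hasDerivAt_add_div (ha.1 t) (hE' t) (hD t) (ne_of_gt ht)
    obtain ⟨Ca, hCa⟩ := ha.2
    obtain ⟨Cq, hCq⟩ := hQb
    set M := Cq + 2 * Ca
    have hM : ∀ t, |Q t - 2 * a t| ≤ M := fun t => by
      have h1 := abs_le.1 (hCq t)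
      have h2 := abs_le.1 (hCa t)
      exact abs_le.2 ⟨by linarith, by linarith⟩
    refine ⟨Ca + (-z + M), (eventually_le_atBot s).mono fun t hts => ?_⟩
    have hDt : E s ≤ D t := hDs ▸ hDanti hts
    have hDt0 : 0 < D t := (hE s).trans_le hDt
    refine ⟨hmax.1 hDt0, ?_⟩
    rw [← hmax.2 t hDt0]
    have hmono : Monotone (fun x => M * G x + E x) :=
      monotone_of_forall_hasDerivAt_nonneg (fun x => ((hG x).const_mul M).add (hE' x)) fun x => by
        have := abs_le.1 (hM x)
        nlinarith [hE x]
    have h1 := hmono hts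
    simp only at h1
    have hM0 : 0 ≤ M := (abs_nonneg _).trans (hM t)
    have h2 : |z * E t / D t| ≤ -z + M := by
      rw [abs_div, abs_mul, abs_of_nonpos hz, abs_of_pos (hE t), abs_of_pos hDt0,
        div_le_iff₀ hDt0]
      have h3 : -z * E t ≤ -z * (E s + M * (G s - G t)) :=
        mul_le_mul_of_nonneg_left (by linarith) (by linarith)
      have h4 : -z * E s ≤ -z * D t := mul_le_mul_of_nonneg_left hDt (by linarith)
      have h5 : 0 ≤ M * E s := mul_nonneg hM0 (hE s).le
      simp only [D] at h4 ⊢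
      nlinarith
    exact (abs_add_le _ _).trans (add_le_add (hCa t) h2)

theorem le_of_hasTopWitness {Q P a b : ℝ → ℝ} {ε : ℝ} (hQ : Continuous Q) (hε : 0 < ε)
    (ha : IsBddSol Q (fun t => P t + ε) a) (hw : HasTopWitness Q a) (hb : IsBddSol Q P b) (s : ℝ) :
    b s ≤ a s := by
  obtain ⟨E, G, hE, hE', hG, hun⟩ := hw
  have hGm := strictMono_of_forall_hasDerivAt_pos hE hG
  have hGc := continuous_of_forall_hasDerivAt hG
  have hac := continuous_of_forall_hasDerivAt ha.1
  have hbc := continuous_of_forall_hasDerivAt hb.1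
  by_contra! hlt
  have he : 0 < b s - a s := by linarith
  set g := G s - E s / (b s - a s)
  obtain ⟨H, hH, hH'⟩ := exists_pos_linear_solution
    (c := fun t => Q t - a t - b t) (by fun_prop)
  set N : ℝ → ℝ := fun t => (E t - (b t - a t) * (G t - g)) / H t
  have hN : ∀ t, HasDerivAt N (ε * (G t - g) / H t) t := fun t => by
    have h0 := (hH t).ne'
    refine HasDerivAt.congr_deriv
      (((hE' t).sub (((hb.1 t).sub (ha.1 t)).mul ((hG t).sub_const g))).div (hH' t) h0) ?_
    simp only [quadF, Pi.sub_apply, Pi.mul_apply]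
    field_simp
    ring
  obtain ⟨t, ht⟩ := hun g
  have hgs : g < G s := by
    have := div_pos (hE s) he
    simp only [g]
    linarith
  have hts : t < s := hGm.lt_iff_lt.1 (ht.trans hgs)
  obtain ⟨T, hT, hTg⟩ := intermediate_value_Ioo hts.le hGc.continuousOn
    (show g ∈ Ioo (G t) (G s) from ⟨ht, hgs⟩)
  have hmono : MonotoneOn N (Icc T s) := by
    refine monotoneOn_of_hasDerivWithinAt_nonneg (convex_Icc T s)
      (fun x _ => (hN x).continuousAt.continuousWithinAt)
      (fun x _ => (hN x).hasDerivWithinAt) (fun x hx => ?_)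
    rw [interior_Icc] at hx
    have := hGm hx.1
    exact div_nonneg (mul_nonneg hε.le (by linarith)) (hH x).le
  have h1 := hmono (left_mem_Icc.2 hT.2.le) (right_mem_Icc.2 hT.2.le) hT.2.le
  have h2 : N s = 0 := by
    simp only [N, g, sub_sub_cancel, mul_div_cancel₀ _ he.ne', sub_self, zero_div]
  have h3 : 0 < N T := by
    simp only [N, hTg, sub_self, mul_zero, sub_zero]
    exact div_pos (hE T) (hH T)
  linarith

theorem exists_gap_of_hasTopWitness {Q P a b : ℝ → ℝ} {ε : ℝ} (hQ : Continuous Q)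
    (hQb : ∃ C, ∀ t, |Q t| ≤ C) (hε : 0 < ε)
    (ha : IsBddSol Q (fun t => P t + ε) a) (hw : HasTopWitness Q a) (hb : IsBddSol Q P b) :
    ∃ δ > 0, ∀ t, δ ≤ a t - b t := by
  obtain ⟨Ca, hCa⟩ := ha.2
  obtain ⟨Cb, hCb⟩ := hb.2
  obtain ⟨Cq, hCq⟩ := hQb
  set K := Cq + Ca + Cb + 1
  have hK : ∀ t, |Q t - a t - b t| ≤ K := fun t => by
    have h1 := abs_le.1 (hCq t)
    have h2 := abs_le.1 (hCa t)
    have h3 := abs_le.1 (hCb t)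
    exact abs_le.2 ⟨by linarith, by linarith⟩
  have hK0 : 0 < K := by
    have h1 := (abs_nonneg _).trans (hCq 0)
    have h2 := (abs_nonneg _).trans (hCa 0)
    have h3 := (abs_nonneg _).trans (hCb 0)
    positivity
  have hle := le_of_hasTopWitness hQ hε ha hw hb
  refine ⟨ε / K, by positivity, fun s => ?_⟩
  have hexp : ∀ t, HasDerivAt (fun t => Real.exp (K * t)) (Real.exp (K * t) * K) t := fun t => by
    simpa using ((hasDerivAt_id t).const_mul K).exp
  have hmono : Monotone (fun t => (a t - b t - ε / K) * Real.exp (K * t)) := by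
    refine monotone_of_forall_hasDerivAt_nonneg
      (f' := fun t => (a t - b t) * (Q t - a t - b t + K) * Real.exp (K * t))
      (fun t => ?_) fun t => ?_
    · refine HasDerivAt.congr_deriv ((((ha.1 t).sub (hb.1 t)).sub_const (ε / K)).mul (hexp t)) ?_
      simp only [quadF, Pi.sub_apply]
      field_simp
      ring
    · have := abs_le.1 (hK t)
      exact mul_nonneg (mul_nonneg (by linarith [hle t]) (by linarith)) (Real.exp_pos _).le
  have hlim : Tendsto (fun t => -(ε / K) * Real.exp (K * t)) atBot (nhds 0) := by
    have := (Real.tendsto_exp_atBot.comp (tendsto_id.const_mul_atBot hK0)).const_mul (-(ε / K))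
    simpa using this
  have h0 : 0 ≤ (a s - b s - ε / K) * Real.exp (K * s) := by
    refine le_of_tendsto hlim ((eventually_le_atBot s).mono fun t hts => ?_)
    refine le_trans ?_ (hmono hts)
    exact mul_le_mul_of_nonneg_right (by linarith [hle t]) (Real.exp_pos _).le
  linarith [nonneg_of_mul_nonneg_left h0 (Real.exp_pos _)]

/-- The change of variables `(t, x) ↦ (-t, -x)` on families of maximal solutions. -/
def MaxSolFamily.reflect {Q P : ℝ → ℝ} (F : MaxSolFamily (quadF Q P)) :
    MaxSolFamily (quadF (fun t => -Q (-t)) (fun t => P (-t))) where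
  X t s x₀ := -F.X (-t) (-s) (-x₀)
  dom s x₀ := Neg.neg ⁻¹' F.dom (-s) (-x₀)
  dom_open s x₀ := (F.dom_open _ _).preimage continuous_neg
  dom_ordConn s x₀ := ⟨fun _ hx _ hy _ hz =>
    (F.dom_ordConn _ _).out hy hx ⟨neg_le_neg hz.2, neg_le_neg hz.1⟩⟩
  mem_dom s x₀ := F.mem_dom _ _
  init s x₀ := by simp [F.init]
  sol s x₀ t ht := by
    refine HasDerivAt.congr_deriv (((F.sol _ _ (-t) ht).scomp t (hasDerivAt_neg t)).neg) ?_
    simp [quadF]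
  maximal s x₀ y I hIo hIc hs hy hsol := by
    have h := F.maximal (-s) (-x₀) (fun t => -y (-t)) (Neg.neg ⁻¹' I) (hIo.preimage continuous_neg)
      ⟨fun _ hx _ hy _ hz => hIc.out hy hx ⟨neg_le_neg hz.2, neg_le_neg hz.1⟩⟩ (by simpa) (by simpa)
      fun t ht => by
        refine HasDerivAt.congr_deriv (((hsol (-t) ht).scomp t (hasDerivAt_neg t)).neg) ?_
        simp [quadF]
    refine ⟨fun t ht => h.1 (by simpa using ht), fun t ht => ?_⟩
    have := h.2 (-t) (by simpa using ht)
    simp only [neg_neg] at this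
    linarith

theorem IsBddSol.reflect {Q P b : ℝ → ℝ} (hb : IsBddSol Q P b) :
    IsBddSol (fun t => -Q (-t)) (fun t => P (-t)) (fun t => -b (-t)) := by
  refine ⟨fun t => ?_, ?_⟩
  · refine HasDerivAt.congr_deriv (((hb.1 (-t)).scomp t (hasDerivAt_neg t)).neg) ?_
    simp [quadF]
  · obtain ⟨C, hC⟩ := hb.2
    exact ⟨C, fun t => by simpa using hC (-t)⟩

theorem CharA.charR_reflect {Q P a : ℝ → ℝ} {F : MaxSolFamily (quadF Q P)}
    (ha : CharA F.reflect a) : CharR F (fun t => -a (-t)) := by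
  have hsol := IsBddSol.reflect ⟨ha.1, ha.2.1⟩
  simp only [neg_neg] at hsol
  refine ⟨hsol.1, hsol.2, fun s x₀ => ?_⟩
  have h := ha.2.2 (-s) (-x₀)
  rw [← neg_le] at h
  rw [← h]
  refine exists_congr fun C => ?_
  rw [← map_neg_atTop, eventually_map]
  simp [MaxSolFamily.reflect]

theorem IsBddSol.le_of_charA {Q P a b : ℝ → ℝ} {F : MaxSolFamily (quadF Q P)}
    (ha : CharA F a) (hb : IsBddSol Q P b) (s : ℝ) : b s ≤ a s := by
  obtain ⟨C, hC⟩ := hb.2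
  have h := F.maximal s (b s) b univ isOpen_univ ordConnected_univ (mem_univ s) rfl
    fun t _ => hb.1 t
  exact (ha.2.2 s (b s)).1
    ⟨C, .of_forall fun t => ⟨h.1 (mem_univ t), h.2 t (mem_univ t) ▸ hC t⟩⟩

theorem IsBddSol.ge_of_charR {Q P r b : ℝ → ℝ} {F : MaxSolFamily (quadF Q P)}
    (hr : CharR F r) (hb : IsBddSol Q P b) (s : ℝ) : r s ≤ b s := by
  obtain ⟨C, hC⟩ := hb.2
  have h := F.maximal s (b s) b univ isOpen_univ ordConnected_univ (mem_univ s) rfl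
    fun t _ => hb.1 t
  exact (hr.2.2 s (b s)).1
    ⟨C, .of_forall fun t => ⟨h.1 (mem_univ t), h.2 t (mem_univ t) ▸ hC t⟩⟩

theorem IsBddSol.sub_eq {Q P x y : ℝ → ℝ} (hQ : Continuous Q) (hx : IsBddSol Q P x)
    (hy : IsBddSol Q P y) (s t : ℝ) :
    x t - y t = (x s - y s) * Real.exp (∫ l in s..t, (Q l - x l - y l)) := by
  have hxc := continuous_of_forall_hasDerivAt hx.1
  have hyc := continuous_of_forall_hasDerivAt hy.1
  refine linear_solution_eq (d := fun t => x t - y t) (by fun_prop) (fun t => ?_) s t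
  refine HasDerivAt.congr_deriv ((hx.1 t).sub (hy.1 t)) ?_
  simp only [quadF]
  ring

theorem exists_dich_of_gap {Q P a r : ℝ → ℝ} {δ : ℝ} (hQ : Continuous Q)
    (ha : IsBddSol Q P a) (hr : IsBddSol Q P r) (hδ : 0 < δ) (hgap : ∀ t, δ ≤ a t - r t) :
    ∃ k, AttrDich Q a k δ ∧ RepDich Q r k δ := by
  have hac := continuous_of_forall_hasDerivAt ha.1
  have hrc := continuous_of_forall_hasDerivAt hr.1
  obtain ⟨Ca, hCa⟩ := ha.2
  obtain ⟨Cr, hCr⟩ := hr.2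
  have hup : ∀ t, a t - r t ≤ Ca + Cr := fun t => by
    have h2 := abs_le.1 (hCa t)
    have h3 := abs_le.1 (hCr t)
    linarith
  have hexp : ∀ s t, Real.exp (∫ l in s..t, (Q l - a l - r l)) ≤ (Ca + Cr) / δ := fun s t => by
    rw [le_div_iff₀ hδ, mul_comm]
    calc δ * _ ≤ (a s - r s) * _ := mul_le_mul_of_nonneg_right (hgap s) (Real.exp_pos _).le
      _ = a t - r t := (ha.sub_eq hQ hr s t).symm
      _ ≤ _ := hup t
  have hk : 1 ≤ (Ca + Cr) / δ := by
    rw [le_div_iff₀ hδ, one_mul]; exact (hgap 0).trans (hup 0)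
  refine ⟨(Ca + Cr) / δ, ⟨hk, hδ, fun s t hst => ?_⟩, hk, hδ, fun s t hts => ?_⟩
  · have h1 : ∫ l in s..t, (-2 * a l + Q l) ≤ ∫ l in s..t, ((Q l - a l - r l) + -δ) := by
      refine intervalIntegral.integral_mono_on hst
        (Continuous.intervalIntegrable (by fun_prop) _ _)
        (Continuous.intervalIntegrable (by fun_prop) _ _) fun l _ => ?_
      linarith [hgap l]
    rw [intervalIntegral.integral_add (f := fun l => Q l - a l - r l)
      (Continuous.intervalIntegrable (by fun_prop) _ _)
      (by simp), intervalIntegral.integral_const, smul_eq_mul, mul_comm (t - s)] at h1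
    refine (Real.exp_le_exp.2 h1).trans ?_
    rw [Real.exp_add]
    exact mul_le_mul_of_nonneg_right (hexp s t) (Real.exp_pos _).le
  · have h1 : ∫ l in t..s, ((Q l - a l - r l) + δ) ≤ ∫ l in t..s, (-2 * r l + Q l) := by
      refine intervalIntegral.integral_mono_on hts
        (Continuous.intervalIntegrable (by fun_prop) _ _)
        (Continuous.intervalIntegrable (by fun_prop) _ _) fun l _ => ?_
      linarith [hgap l]
    rw [intervalIntegral.integral_add (f := fun l => Q l - a l - r l)
      (Continuous.intervalIntegrable (by fun_prop) _ _)
      (by simp), intervalIntegral.integral_const, smul_eq_mul, mul_comm (s - t),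
      intervalIntegral.integral_symm s t, intervalIntegral.integral_symm s t] at h1
    have h2 : ∫ l in s..t, (-2 * r l + Q l) ≤ (∫ l in s..t, (Q l - a l - r l)) + δ * (t - s) := by
      linarith
    refine (Real.exp_le_exp.2 h2).trans ?_
    rw [Real.exp_add]
    exact mul_le_mul_of_nonneg_right (hexp s t) (Real.exp_pos _).le

theorem eq_of_attrDich_of_le {Q P a b : ℝ → ℝ} {k β : ℝ} (hQ : Continuous Q)
    (ha : IsBddSol Q P a) (hb : IsBddSol Q P b) (hle : ∀ t, b t ≤ a t) (hd : AttrDich Q b k β) :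
    b = a := by
  have hac := continuous_of_forall_hasDerivAt ha.1
  have hbc := continuous_of_forall_hasDerivAt hb.1
  obtain ⟨Ca, hCa⟩ := ha.2
  obtain ⟨Cb, hCb⟩ := hb.2
  obtain ⟨hk, hβ, hd⟩ := hd
  funext t
  refine le_antisymm (hle t) (sub_nonpos.1 ?_)
  have hlim : Tendsto (fun s => (Ca + Cb) * (k * Real.exp (-β * (t - s)))) atBot (nhds 0) := by
    have h1 : Tendsto (fun s => -β * (t - s)) atBot atBot :=
      (tendsto_atTop_add_const_left _ t tendsto_neg_atBot_atTop).const_mul_atTop_of_neg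
        (neg_lt_zero.2 hβ)
    simpa using ((Real.tendsto_exp_atBot.comp h1).const_mul k).const_mul (Ca + Cb)
  refine ge_of_tendsto hlim ((eventually_le_atBot t).mono fun s hst => ?_)
  have h1 : ∫ l in s..t, (Q l - a l - b l) ≤ ∫ l in s..t, (-2 * b l + Q l) := by
    refine intervalIntegral.integral_mono_on hst
      (Continuous.intervalIntegrable (by fun_prop) _ _)
      (Continuous.intervalIntegrable (by fun_prop) _ _) fun l _ => ?_
    linarith [hle l]
  rw [ha.sub_eq hQ hb s t]
  have h2 := abs_le.1 (hCa s)
  have h3 := abs_le.1 (hCb s)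
  exact mul_le_mul (by linarith) ((Real.exp_le_exp.2 h1).trans (hd s t hst)) (Real.exp_pos _).le
    (by linarith [hle s])

theorem AttrDich.of_repDich_reflect {Q b : ℝ → ℝ} {k β : ℝ} (hd : RepDich Q b k β) :
    AttrDich (fun t => -Q (-t)) (fun t => -b (-t)) k β := by
  refine ⟨hd.1, hd.2.1, fun s t hst => ?_⟩
  have h := hd.2.2 (-s) (-t) (neg_le_neg hst)
  have hint : ∫ l in s..t, (-2 * -b (-l) + -Q (-l)) = ∫ l in -s..-t, (-2 * b l + Q l) := by
    rw [intervalIntegral.integral_symm (-t) (-s),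
      ← intervalIntegral.integral_comp_neg (fun l => -2 * b l + Q l),
      ← intervalIntegral.integral_neg]
    congr 1
    funext l
    ring
  rw [hint]
  convert h using 3
  ring

theorem eq_of_repDich_of_ge {Q P r b : ℝ → ℝ} {k β : ℝ} (hQ : Continuous Q)
    (hr : IsBddSol Q P r) (hb : IsBddSol Q P b) (hle : ∀ t, r t ≤ b t) (hd : RepDich Q b k β) :
    b = r := by
  have h := eq_of_attrDich_of_le (by fun_prop) hr.reflect hb.reflect
    (fun t => neg_le_neg (hle (-t))) (AttrDich.of_repDich_reflect hd)
  funext t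
  simpa using congrFun h (-t)

theorem stmt14 (q p : ℝ → ℝ)
    (hqb : ∃ C, ∀ t, |q t| ≤ C) (hqu : UniformContinuous q)
    (hpb : ∃ C, ∀ t, |p t| ≤ C) (hpu : UniformContinuous p)
    (F : ∀ lam : ℝ, MaxSolFamily (quadF q (fun t => p t + lam)))
    (lamstar : ℝ)
    (hstar : ∀ lam : ℝ, (∃ b : ℝ → ℝ, IsBddSol q (fun t => p t + lam) b) ↔ lamstar ≤ lam) :
    -- for λ > λ*: uniformly separated hyperbolic solutions, and no others
    (∀ lam : ℝ, lamstar < lam →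
      ∃ a r : ℝ → ℝ, CharA (F lam) a ∧ CharR (F lam) r ∧
        (∃ δ > (0:ℝ), ∀ t, δ ≤ a t - r t) ∧
        IsAttrHyp q (fun t => p t + lam) a ∧
        IsRepHyp q (fun t => p t + lam) r ∧
        (∀ b : ℝ → ℝ, IsHyp q (fun t => p t + lam) b → b = a ∨ b = r)) ∧
    -- λ*(q, p + μ) = λ*(q, p) − μ
    (∀ μ lamstar' : ℝ,
      (∀ lam : ℝ, (∃ b : ℝ → ℝ, IsBddSol q (fun t => p t + μ + lam) b) ↔ lamstar' ≤ lam) →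
      lamstar' = lamstar - μ) := by
  have hqc := hqu.continuous
  refine ⟨fun lam hlam => ?_, fun μ lamstar' h => ?_⟩
  · obtain ⟨b₀, hb₀⟩ := (hstar lamstar).2 le_rfl
    obtain ⟨b, hb⟩ := (hstar lam).2 hlam.le
    obtain ⟨a, ha, hwa⟩ := exists_hasTopWitness hqc hqb hb
    have hqb' : ∃ C, ∀ t, |-q (-t)| ≤ C := by
      obtain ⟨C, hC⟩ := hqb
      exact ⟨C, fun t => by simpa using hC (-t)⟩
    obtain ⟨r', hr', hwr⟩ := exists_hasTopWitness (by fun_prop) hqb' hb.reflect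
    have hA := charA_of_hasTopWitness hqb (F lam) ha hwa
    have hR := (charA_of_hasTopWitness hqb' (F lam).reflect hr' hwr).charR_reflect
    have hr : IsBddSol q (fun t => p t + lam) (fun t => -r' (-t)) := ⟨hR.1, hR.2.1⟩
    have hε : 0 < lam - lamstar := sub_pos.2 hlam
    obtain ⟨δ₁, hδ₁, hgap₁⟩ := exists_gap_of_hasTopWitness (P := fun t => p t + lamstar)
      (ε := lam - lamstar) hqc hqb hε (by simpa [add_assoc] using ha) hwa hb₀
    obtain ⟨δ₂, hδ₂, hgap₂⟩ := exists_gap_of_hasTopWitness (P := fun t => p (-t) + lamstar)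
      (ε := lam - lamstar) (by fun_prop) hqb' hε (by simpa [add_assoc] using hr') hwr hb₀.reflect
    have hgap : ∀ t, δ₁ + δ₂ ≤ a t - -r' (-t) := fun t => by
      have h1 := hgap₁ t
      have h2 := hgap₂ (-t)
      rw [neg_neg] at h2
      linarith
    obtain ⟨k, hka, hkr⟩ := exists_dich_of_gap hqc ha hr (add_pos hδ₁ hδ₂) hgap
    refine ⟨a, _, hA, hR, ⟨_, add_pos hδ₁ hδ₂, hgap⟩, ⟨ha, k, _, hka⟩, ⟨hr, k, _, hkr⟩, ?_⟩
    rintro c (⟨hc, k', β, hd⟩ | ⟨hc, k', β, hd⟩)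
    · exact .inl (eq_of_attrDich_of_le hqc ha hc (hc.le_of_charA hA) hd)
    · exact .inr (eq_of_repDich_of_ge hqc hr hc (hc.ge_of_charR hR) hd)
  · have key : ∀ lam, lamstar' ≤ lam ↔ lamstar ≤ μ + lam := fun lam => by
      rw [← h lam, ← hstar (μ + lam)]
      simp only [add_assoc]
    have h1 := (key lamstar').1 le_rfl
    have h2 := (key (lamstar - μ)).2 (by linarith)
    linarith
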